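/- arXiv:2209.06118 — 2 statements merged into one kernel-verified Lean document; each statement's English description precedes it below -/
import Mathlib

section
/- Let H be an n×n complex matrix with H*H ≤ I (a contraction). Then the reduced relative quantum entropy S_H(A∣B) = Tr(A log A − H*AH log B − A + B) is jointly convex in pairs (A, B) of positive definite n×n complex matrices; that is, for positive definite A₁, A₂, B₁, B₂ and t ∈ [0,1], S_H(tA₁+(1−t)A₂ ∣ tB₁+(1−t)B₂) ≤ t·S_H(A₁∣B₁) + (1−t)·S_H(A₂∣B₂). -/
open Matrix ComplexOrder

/-- Matrix logarithm via the continuous functional calculus. -/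
noncomputable def mlog {N : Type*} [Fintype N] [DecidableEq N]
    (A : Matrix N N ℂ) : Matrix N N ℂ :=
  cfc Real.log A

/-- Reduced relative quantum entropy `S_H(A∣B) = Tr(A log A − H*AH log B − A + B)`. -/
noncomputable def reducedRelativeEntropy {N : Type*} [Fintype N] [DecidableEq N]
    (H A B : Matrix N N ℂ) : ℂ :=
  (A * mlog A - Hᴴ * A * H * mlog B - A + B).trace


namespace RRE

variable {n : ℕ}


/-- Spectral data for a positive definite matrix. -/
structure Spec (A : Matrix (Fin n) (Fin n) ℂ) where
  U : Matrix (Fin n) (Fin n) ℂ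
  a : Fin n → ℝ
  pos : ∀ i, 0 < a i
  h1 : Uᴴ * U = 1
  h2 : U * Uᴴ = 1
  eq : A = U * diagonal (fun i => (a i : ℂ)) * Uᴴ
  log : mlog A = U * diagonal (fun i => (Real.log (a i) : ℂ)) * Uᴴ

lemma exists_spec {A : Matrix (Fin n) (Fin n) ℂ} (hA : A.PosDef) : Nonempty (Spec A) := by
  refine ⟨⟨hA.1.eigenvectorUnitary, hA.1.eigenvalues, hA.eigenvalues_pos, ?_, ?_, ?_, ?_⟩⟩
  · exact Unitary.coe_star_mul_self hA.1.eigenvectorUnitary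
  · exact Unitary.coe_mul_star_self hA.1.eigenvectorUnitary
  · have := hA.1.spectral_theorem
    rw [Unitary.conjStarAlgAut_apply] at this
    exact this
  · rw [mlog, hA.1.cfc_eq, IsHermitian.cfc, Unitary.conjStarAlgAut_apply]
    rfl

lemma tr_formula (U V X Y : Matrix (Fin n) (Fin n) ℂ) (p q : Fin n → ℂ) :
    (Xᴴ * (U * diagonal p * Uᴴ) * Y * (V * diagonal q * Vᴴ)).trace =
      ∑ i, ∑ j, star ((Uᴴ * X * V) i j) * (Uᴴ * Y * V) i j * p i * q j := by
  have e : (Xᴴ * (U * diagonal p * Uᴴ) * Y * (V * diagonal q * Vᴴ)).trace =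
      ((Uᴴ * X * V)ᴴ * (diagonal p * (Uᴴ * Y * V) * diagonal q)).trace := by
    simp only [conjTranspose_mul, conjTranspose_conjTranspose]
    rw [← Matrix.mul_assoc _ _ (Vᴴ), trace_mul_comm]
    simp only [Matrix.mul_assoc]
  rw [e, trace, Finset.sum_comm]
  refine Finset.sum_congr rfl fun j _ => ?_
  rw [diag_apply, Matrix.mul_apply]
  refine Finset.sum_congr rfl fun i _ => ?_
  rw [mul_diagonal, diagonal_mul, conjTranspose_apply]
  ring

/-- weights -/
noncomputable def wt {A B : Matrix (Fin n) (Fin n) ℂ} (H : Matrix (Fin n) (Fin n) ℂ)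
    (s : Spec A) (r : Spec B) (i j : Fin n) : ℝ :=
  Complex.normSq ((s.Uᴴ * H * r.U) i j)

lemma tr_real {A B : Matrix (Fin n) (Fin n) ℂ} (H : Matrix (Fin n) (Fin n) ℂ)
    (s : Spec A) (r : Spec B) (p q : Fin n → ℝ) :
    (Hᴴ * (s.U * diagonal (fun i => (p i : ℂ)) * s.Uᴴ) * H *
      (r.U * diagonal (fun i => (q i : ℂ)) * r.Uᴴ)).trace =
      ((∑ i, ∑ j, wt H s r i j * p i * q j : ℝ) : ℂ) := by
  rw [tr_formula]
  push_cast
  refine Finset.sum_congr rfl fun i _ => Finset.sum_congr rfl fun j _ => ?_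
  rw [wt, Complex.normSq_eq_conj_mul_self]
  rfl

/-- The functional. -/
noncomputable def F (H A B : Matrix (Fin n) (Fin n) ℂ) : ℂ :=
  (Hᴴ * (A * mlog A) * H - Hᴴ * A * H * mlog B).trace

lemma Spec.one {A : Matrix (Fin n) (Fin n) ℂ} (s : Spec A) :
    (1 : Matrix (Fin n) (Fin n) ℂ) = s.U * diagonal (fun _ => ((1 : ℝ) : ℂ)) * s.Uᴴ := by
  simp [s.h2]

lemma Spec.mul_log {A : Matrix (Fin n) (Fin n) ℂ} (s : Spec A) :
    A * mlog A = s.U * diagonal (fun i => ((s.a i * Real.log (s.a i) : ℝ) : ℂ)) * s.Uᴴ := by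
  rw [s.log]
  conv_lhs => enter [1]; rw [s.eq]
  have : s.U * diagonal (fun i => (s.a i : ℂ)) * s.Uᴴ *
      (s.U * diagonal (fun i => (Real.log (s.a i) : ℂ)) * s.Uᴴ) =
      s.U * diagonal (fun i => (s.a i : ℂ)) * (s.Uᴴ * s.U) *
       diagonal (fun i => (Real.log (s.a i) : ℂ)) * s.Uᴴ := by
    simp only [Matrix.mul_assoc]
  rw [this, s.h1, Matrix.mul_one, Matrix.mul_assoc s.U, diagonal_mul_diagonal]
  simp

lemma F_eq {A B : Matrix (Fin n) (Fin n) ℂ} (H : Matrix (Fin n) (Fin n) ℂ)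
    (s : Spec A) (r : Spec B) :
    F H A B = ((∑ i, ∑ j, wt H s r i j *
      (s.a i * (Real.log (s.a i) - Real.log (r.a j))) : ℝ) : ℂ) := by
  have h1 := tr_real H s r (fun i => s.a i * Real.log (s.a i)) (fun _ => 1)
  have h2 := tr_real H s r s.a (fun j => Real.log (r.a j))
  rw [← s.mul_log, ← r.one, Matrix.mul_one] at h1
  rw [← s.eq, ← r.log] at h2
  rw [F, trace_sub, h1, h2, ← Complex.ofReal_sub, ← Finset.sum_sub_distrib]
  congr 1
  refine Finset.sum_congr rfl fun i _ => ?_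
  rw [← Finset.sum_sub_distrib]
  refine Finset.sum_congr rfl fun j _ => ?_
  ring

/-- Affine functional in `(A, B)`. -/
noncomputable def L (x : ℝ) (H Z A B : Matrix (Fin n) (Fin n) ℂ) : ℝ :=
  (2 * (Zᴴ * H * B).trace - (Zᴴ * A * Z).trace - (x : ℂ) * (Zᴴ * Z * B).trace).re

noncomputable def Q {A B : Matrix (Fin n) (Fin n) ℂ} (x : ℝ) (H : Matrix (Fin n) (Fin n) ℂ)
    (s : Spec A) (r : Spec B) : ℝ :=
  ∑ i, ∑ j, wt H s r i j * (r.a j ^ 2 / (s.a i + x * r.a j))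

lemma L_eq {A B : Matrix (Fin n) (Fin n) ℂ} (x : ℝ) (H Z : Matrix (Fin n) (Fin n) ℂ)
    (s : Spec A) (r : Spec B) :
    L x H Z A B = ∑ i, ∑ j, (2 * (star ((s.Uᴴ * Z * r.U) i j) * (s.Uᴴ * H * r.U) i j).re * r.a j
      - (s.a i + x * r.a j) * Complex.normSq ((s.Uᴴ * Z * r.U) i j)) := by
  have h1 := tr_formula s.U r.U Z H (fun _ => ((1 : ℝ) : ℂ)) (fun j => (r.a j : ℂ))
  have h2 := tr_real Z s r s.a (fun _ => 1)
  have h3 := tr_real Z s r (fun _ => 1) r.a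
  rw [← s.one, ← r.eq, Matrix.mul_one] at h1 h3
  rw [← s.eq, ← r.one, Matrix.mul_one] at h2
  rw [L, h1, h2, h3]
  simp only [Finset.mul_sum, ← Complex.ofReal_mul, Complex.sub_re, Complex.re_sum,
    Complex.ofReal_re, ← Finset.sum_sub_distrib]
  refine Finset.sum_congr rfl fun i _ => Finset.sum_congr rfl fun j _ => ?_
  rw [wt]
  simp
  ring

lemma scalar_le (z w : ℂ) (b m : ℝ) (hm : 0 < m) :
    2 * (star z * w).re * b - m * Complex.normSq z ≤ Complex.normSq w * (b ^ 2 / m) := by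
  rw [← mul_div_assoc, le_div_iff₀ hm]
  simp only [Complex.normSq_apply, Complex.star_def, Complex.mul_re, Complex.conj_re,
    Complex.conj_im]
  nlinarith [sq_nonneg (w.re * b - m * z.re), sq_nonneg (w.im * b - m * z.im)]

lemma L_le_Q {A B : Matrix (Fin n) (Fin n) ℂ} {x : ℝ} (hx : 0 ≤ x)
    (H Z : Matrix (Fin n) (Fin n) ℂ) (s : Spec A) (r : Spec B) :
    L x H Z A B ≤ Q x H s r := by
  rw [L_eq x H Z s r, Q]
  refine Finset.sum_le_sum fun i _ => Finset.sum_le_sum fun j _ => ?_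
  exact scalar_le _ _ _ _ (add_pos_of_pos_of_nonneg (s.pos i) (mul_nonneg hx (r.pos j).le))

lemma exists_L_eq_Q {A B : Matrix (Fin n) (Fin n) ℂ} {x : ℝ} (hx : 0 ≤ x)
    (H : Matrix (Fin n) (Fin n) ℂ) (s : Spec A) (r : Spec B) :
    ∃ Z, L x H Z A B = Q x H s r := by
  let z : Matrix (Fin n) (Fin n) ℂ := Matrix.of fun i j =>
    ((r.a j / (s.a i + x * r.a j) : ℝ) : ℂ) * (s.Uᴴ * H * r.U) i j
  refine ⟨s.U * z * r.Uᴴ, ?_⟩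
  have hz : s.Uᴴ * (s.U * z * r.Uᴴ) * r.U = z := by
    have : s.Uᴴ * (s.U * z * r.Uᴴ) * r.U = (s.Uᴴ * s.U) * z * (r.Uᴴ * r.U) := by
      simp only [Matrix.mul_assoc]
    rw [this, s.h1, r.h1, Matrix.one_mul, Matrix.mul_one]
  rw [L_eq x H _ s r, Q, hz]
  refine Finset.sum_congr rfl fun i _ => Finset.sum_congr rfl fun j _ => ?_
  have hm : s.a i + x * r.a j ≠ 0 :=
    (add_pos_of_pos_of_nonneg (s.pos i) (mul_nonneg hx (r.pos j).le)).ne'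
  simp only [z, Matrix.of_apply, wt]
  generalize (s.Uᴴ * H * r.U) i j = w
  generalize s.a i + x * r.a j = m at hm
  simp only [Complex.normSq_apply, Complex.star_def, Complex.mul_re, Complex.conj_re,
    Complex.conj_im, Complex.mul_im, Complex.ofReal_re, Complex.ofReal_im]
  field_simp
  ring

lemma Q_convex {A₁ A₂ B₁ B₂ : Matrix (Fin n) (Fin n) ℂ} {x : ℝ} (hx : 0 ≤ x)
    (H : Matrix (Fin n) (Fin n) ℂ) (t : ℝ) (ht0 : 0 ≤ t) (ht1 : t ≤ 1)
    (s₁ : Spec A₁) (r₁ : Spec B₁) (s₂ : Spec A₂) (r₂ : Spec B₂)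
    (s : Spec (t • A₁ + (1 - t) • A₂)) (r : Spec (t • B₁ + (1 - t) • B₂)) :
    Q x H s r ≤ t * Q x H s₁ r₁ + (1 - t) * Q x H s₂ r₂ := by
  obtain ⟨Z, hZ⟩ := exists_L_eq_Q hx H s r
  have h1 := mul_le_mul_of_nonneg_left (L_le_Q hx H Z s₁ r₁) ht0
  have h2 := mul_le_mul_of_nonneg_left (L_le_Q hx H Z s₂ r₂) (sub_nonneg.2 ht1)
  have : L x H Z (t • A₁ + (1 - t) • A₂) (t • B₁ + (1 - t) • B₂) =
      t * L x H Z A₁ B₁ + (1 - t) * L x H Z A₂ B₂ := by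
    simp only [L, Matrix.mul_add, Matrix.add_mul, Matrix.mul_smul, Matrix.smul_mul, trace_add,
      trace_smul, Complex.real_smul]
    simp
    ring
  linarith

/-- The truncated functional. -/
noncomputable def G {A B : Matrix (Fin n) (Fin n) ℂ} (H : Matrix (Fin n) (Fin n) ℂ)
    (s : Spec A) (r : Spec B) (x : ℝ) : ℝ :=
  ∑ i, ∑ j, wt H s r i j *
    (s.a i * (Real.log (1 + x) - Real.log (s.a i + x * r.a j) + Real.log (s.a i)))

lemma G_zero {A B : Matrix (Fin n) (Fin n) ℂ} (H : Matrix (Fin n) (Fin n) ℂ)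
    (s : Spec A) (r : Spec B) : G H s r 0 = 0 := by
  simp [G]

lemma G_deriv {A B : Matrix (Fin n) (Fin n) ℂ} (H : Matrix (Fin n) (Fin n) ℂ)
    (s : Spec A) (r : Spec B) {x : ℝ} (hx : 0 ≤ x) :
    HasDerivAt (G H s r) ((1 + x)⁻¹ * (Hᴴ * A * H).trace.re - (Hᴴ * H * B).trace.re
      + x * Q x H s r) x := by
  have h2 := tr_real H s r s.a (fun _ => 1)
  have h3 := tr_real H s r (fun _ => 1) r.a
  rw [← s.one, ← r.eq, Matrix.mul_one] at h3
  rw [← s.eq, ← r.one, Matrix.mul_one] at h2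
  rw [h2, h3, Complex.ofReal_re, Complex.ofReal_re, Q]
  simp only [Finset.mul_sum, ← Finset.sum_sub_distrib, ← Finset.sum_add_distrib]
  unfold G
  refine HasDerivAt.fun_sum fun i _ => HasDerivAt.fun_sum fun j _ => ?_
  have hm : s.a i + x * r.a j ≠ 0 :=
    (add_pos_of_pos_of_nonneg (s.pos i) (mul_nonneg hx (r.pos j).le)).ne'
  have hx1 : 1 + x ≠ 0 := by positivity
  have d1 : HasDerivAt (fun y : ℝ => Real.log (1 + y)) (1 / (1 + x)) x :=
    ((hasDerivAt_id x).const_add 1).log hx1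
  have d2 : HasDerivAt (fun y : ℝ => Real.log (s.a i + y * r.a j))
      ((1 * r.a j) / (s.a i + x * r.a j)) x :=
    (((hasDerivAt_id x).mul_const (r.a j)).const_add (s.a i)).log hm
  have d := (((d1.sub d2).add_const (Real.log (s.a i))).const_mul (s.a i)).const_mul (wt H s r i j)
  refine d.congr_deriv ?_
  have e : x * r.a j = (s.a i + x * r.a j) - s.a i := by ring
  have e' : x * (wt H s r i j * (r.a j ^ 2 / (s.a i + x * r.a j))) =
      wt H s r i j * r.a j * ((x * r.a j) / (s.a i + x * r.a j)) := by ring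
  rw [e']
  nth_rewrite 2 [e]
  rw [sub_div, div_self hm]
  ring

lemma G_tendsto {A B : Matrix (Fin n) (Fin n) ℂ} (H : Matrix (Fin n) (Fin n) ℂ)
    (s : Spec A) (r : Spec B) :
    Filter.Tendsto (G H s r) Filter.atTop (nhds (F H A B).re) := by
  rw [F_eq H s r, Complex.ofReal_re]
  unfold G
  refine tendsto_finsetSum _ fun i _ => tendsto_finsetSum _ fun j _ => ?_
  refine Filter.Tendsto.const_mul _ (Filter.Tendsto.const_mul _ ?_)
  have hinv : Filter.Tendsto (fun x : ℝ => x⁻¹) Filter.atTop (nhds 0) := tendsto_inv_atTop_zero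
  have l1 : Filter.Tendsto (fun x : ℝ => Real.log (x⁻¹ + 1)) Filter.atTop (nhds (Real.log (0 + 1))) :=
    (hinv.add_const 1).log (by norm_num)
  have l2 : Filter.Tendsto (fun x : ℝ => Real.log (s.a i * x⁻¹ + r.a j)) Filter.atTop
      (nhds (Real.log (s.a i * 0 + r.a j))) :=
    ((hinv.const_mul (s.a i)).add_const (r.a j)).log (by simpa using (r.pos j).ne')
  have l := (l1.sub l2).add_const (Real.log (s.a i))
  have e : Real.log (0 + 1) - Real.log (s.a i * 0 + r.a j) + Real.log (s.a i) =
      Real.log (s.a i) - Real.log (r.a j) := by simp; ring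
  rw [e] at l
  refine l.congr' ?_
  filter_upwards [Filter.eventually_gt_atTop 0] with x hx
  have hs := s.pos i
  have hr := r.pos j
  have e1 : 1 + x = x * (x⁻¹ + 1) := by field_simp
  have e2 : s.a i + x * r.a j = x * (s.a i * x⁻¹ + r.a j) := by field_simp
  rw [e1, e2, Real.log_mul hx.ne' (by positivity), Real.log_mul hx.ne' (by positivity)]
  ring

lemma posDef_comb {A₁ A₂ : Matrix (Fin n) (Fin n) ℂ} (hA₁ : A₁.PosDef) (hA₂ : A₂.PosDef)
    (t : ℝ) (ht0 : 0 ≤ t) (ht1 : t ≤ 1) : (t • A₁ + (1 - t) • A₂).PosDef := by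
  rcases eq_or_lt_of_le ht0 with h | h
  · subst h; simpa using hA₂
  · exact (hA₁.smul h).add_posSemidef (hA₂.posSemidef.smul (sub_nonneg.2 ht1))

lemma F_im {A B : Matrix (Fin n) (Fin n) ℂ} (H : Matrix (Fin n) (Fin n) ℂ)
    (hA : A.PosDef) (hB : B.PosDef) : (F H A B).im = 0 := by
  obtain ⟨s⟩ := exists_spec hA
  obtain ⟨r⟩ := exists_spec hB
  rw [F_eq H s r, Complex.ofReal_im]

lemma F_convex (H A₁ A₂ B₁ B₂ : Matrix (Fin n) (Fin n) ℂ)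
    (hA₁ : A₁.PosDef) (hA₂ : A₂.PosDef) (hB₁ : B₁.PosDef) (hB₂ : B₂.PosDef)
    (t : ℝ) (ht0 : 0 ≤ t) (ht1 : t ≤ 1) :
    F H (t • A₁ + (1 - t) • A₂) (t • B₁ + (1 - t) • B₂) ≤
      (t : ℂ) * F H A₁ B₁ + (1 - (t : ℂ)) * F H A₂ B₂ := by
  have hA := posDef_comb hA₁ hA₂ t ht0 ht1
  have hB := posDef_comb hB₁ hB₂ t ht0 ht1
  rw [Complex.le_def]
  constructor
  swap
  · simp [F_im H hA hB, F_im H hA₁ hB₁, F_im H hA₂ hB₂]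
  obtain ⟨s⟩ := exists_spec hA
  obtain ⟨r⟩ := exists_spec hB
  obtain ⟨s₁⟩ := exists_spec hA₁
  obtain ⟨r₁⟩ := exists_spec hB₁
  obtain ⟨s₂⟩ := exists_spec hA₂
  obtain ⟨r₂⟩ := exists_spec hB₂
  have key : ∀ x : ℝ, 0 ≤ x → G H s r x ≤ t * G H s₁ r₁ x + (1 - t) * G H s₂ r₂ x := by
    intro x hx
    have hd : ∀ y : ℝ, 0 ≤ y → HasDerivAt
        (fun y => t * G H s₁ r₁ y + (1 - t) * G H s₂ r₂ y - G H s r y) _ y := fun y hy =>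
      (((G_deriv H s₁ r₁ hy).const_mul t).add ((G_deriv H s₂ r₂ hy).const_mul (1 - t))).sub
        (G_deriv H s r hy)
    have hmono : MonotoneOn (fun y => t * G H s₁ r₁ y + (1 - t) * G H s₂ r₂ y - G H s r y)
        (Set.Ici 0) := by
      refine monotoneOn_of_deriv_nonneg (convex_Ici 0)
        (fun y hy => (hd y hy).continuousAt.continuousWithinAt)
        (fun y hy => (hd y (interior_subset hy)).differentiableAt.differentiableWithinAt) ?_
      intro y hy
      have hy0 : 0 ≤ y := interior_subset hy
      rw [(hd y hy0).deriv]
      have hQ := mul_le_mul_of_nonneg_left (Q_convex hy0 H t ht0 ht1 s₁ r₁ s₂ r₂ s r) hy0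
      have e1 : (Hᴴ * (t • A₁ + (1 - t) • A₂) * H).trace.re =
          t * (Hᴴ * A₁ * H).trace.re + (1 - t) * (Hᴴ * A₂ * H).trace.re := by
        simp only [Matrix.mul_add, Matrix.add_mul, Matrix.mul_smul, Matrix.smul_mul, trace_add,
          trace_smul, Complex.add_re, Complex.smul_re, smul_eq_mul]
      have e2 : (Hᴴ * H * (t • B₁ + (1 - t) • B₂)).trace.re =
          t * (Hᴴ * H * B₁).trace.re + (1 - t) * (Hᴴ * H * B₂).trace.re := by
        simp only [Matrix.mul_add, Matrix.mul_smul, trace_add,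
          trace_smul, Complex.add_re, Complex.smul_re, smul_eq_mul]
      rw [e1, e2]
      nlinarith [hQ]
    have := hmono (Set.mem_Ici.2 le_rfl) (Set.mem_Ici.2 hx) hx
    simp only [G_zero] at this
    linarith
  have hl := G_tendsto H s r
  have hr := ((G_tendsto H s₁ r₁).const_mul t).add ((G_tendsto H s₂ r₂).const_mul (1 - t))
  have := le_of_tendsto_of_tendsto hl hr
    ((Filter.eventually_ge_atTop 0).mono fun x hx => key x hx)
  simpa using this

open scoped MatrixOrder in
lemma exists_compl (H : Matrix (Fin n) (Fin n) ℂ) (hH : (1 - Hᴴ * H).PosSemidef) :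
    ∃ C : Matrix (Fin n) (Fin n) ℂ, C * Cᴴ = 1 - H * Hᴴ := by
  have h1 : (H * (1 - Hᴴ * H) * Hᴴ).PosSemidef := hH.mul_mul_conjTranspose_same H
  have h2 := posSemidef_conjTranspose_mul_self (1 - H * Hᴴ)
  have h3 := h1.add h2
  have e : H * (1 - Hᴴ * H) * Hᴴ + (1 - H * Hᴴ)ᴴ * (1 - H * Hᴴ) = 1 - H * Hᴴ := by
    simp only [conjTranspose_sub, conjTranspose_mul, conjTranspose_conjTranspose,
      conjTranspose_one]
    noncomm_ring
  rw [e] at h3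
  obtain ⟨C, hC⟩ := CStarAlgebra.nonneg_iff_eq_star_mul_self.1 h3.nonneg
  exact ⟨Cᴴ, by rw [hC, conjTranspose_conjTranspose]; rfl⟩

lemma mlog_one : mlog (1 : Matrix (Fin n) (Fin n) ℂ) = 0 := by
  rw [mlog, cfc_apply_one, Real.log_one, map_zero]

lemma entropy_eq (H C A B : Matrix (Fin n) (Fin n) ℂ) (hC : C * Cᴴ = 1 - H * Hᴴ) :
    reducedRelativeEntropy H A B = F H A B + F C A 1 - A.trace + B.trace := by
  have h : ∀ X Y : Matrix (Fin n) (Fin n) ℂ, (Xᴴ * Y * X).trace = (X * Xᴴ * Y).trace := by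
    intro X Y
    rw [trace_mul_comm, Matrix.mul_assoc]
  rw [reducedRelativeEntropy, F, F, mlog_one, Matrix.mul_zero, sub_zero, trace_sub, h, h, hC,
    Matrix.sub_mul, Matrix.one_mul, trace_add, trace_sub, trace_sub, trace_sub]
  ring

end RRE

/-- The reduced relative quantum entropy is jointly convex. -/
theorem reducedRelativeEntropy_convex {n : ℕ} (H : Matrix (Fin n) (Fin n) ℂ)
    (hH : (1 - Hᴴ * H).PosSemidef)
    (A₁ A₂ B₁ B₂ : Matrix (Fin n) (Fin n) ℂ)
    (hA₁ : A₁.PosDef) (hA₂ : A₂.PosDef) (hB₁ : B₁.PosDef) (hB₂ : B₂.PosDef)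
    (t : ℝ) (ht0 : 0 ≤ t) (ht1 : t ≤ 1) :
    reducedRelativeEntropy H (t • A₁ + (1 - t) • A₂) (t • B₁ + (1 - t) • B₂) ≤
      (t : ℂ) * reducedRelativeEntropy H A₁ B₁ +
        (1 - (t : ℂ)) * reducedRelativeEntropy H A₂ B₂ := by
  obtain ⟨C, hC⟩ := RRE.exists_compl H hH
  have h1 := RRE.F_convex H A₁ A₂ B₁ B₂ hA₁ hA₂ hB₁ hB₂ t ht0 ht1
  have h2 := RRE.F_convex C A₁ A₂ 1 1 hA₁ hA₂ PosDef.one PosDef.one t ht0 ht1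
  rw [← add_smul, add_sub_cancel, one_smul] at h2
  simp only [RRE.entropy_eq H C _ _ hC, trace_add, trace_smul, Complex.real_smul]
  have h3 := add_le_add (add_le_add h1 h2) (le_refl
    (-((t : ℂ) * A₁.trace + (1 - (t : ℂ)) * A₂.trace)
      + ((t : ℂ) * B₁.trace + (1 - (t : ℂ)) * B₂.trace)))
  convert h3 using 1
  · push_cast; ring
  · ring
end

section
/- Let H be an n×n complex matrix with H*H ≤ I (a contraction). Then the map (A, B) ↦ Tr(H*AH log B − HH*A log A) is jointly concave in pairs (A, B) of positive definite n×n complex matrices. -/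
open Matrix ComplexOrder

lemma pd_diag {n : ℕ} (A : Matrix (Fin n) (Fin n) ℂ) (hA : A.PosDef) :
    ∃ (U : Matrix (Fin n) (Fin n) ℂ) (a : Fin n → ℝ), Uᴴ * U = 1 ∧ U * Uᴴ = 1 ∧ (∀ i, 0 < a i) ∧
      A = U * diagonal (fun i => (a i : ℂ)) * Uᴴ ∧
      mlog A = U * diagonal (fun i => ((Real.log (a i) : ℝ) : ℂ)) * Uᴴ := by
  refine ⟨hA.1.eigenvectorUnitary, hA.1.eigenvalues, ?_, ?_, hA.eigenvalues_pos, ?_, ?_⟩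
  · exact Unitary.coe_star_mul_self hA.1.eigenvectorUnitary
  · exact Unitary.coe_mul_star_self hA.1.eigenvectorUnitary
  · conv_lhs => rw [hA.1.spectral_theorem]
    rfl
  · rw [mlog, hA.1.cfc_eq, Matrix.IsHermitian.cfc]
    rfl

lemma tr_formula {n : ℕ} (U V X Y : Matrix (Fin n) (Fin n) ℂ) (f g : Fin n → ℂ) :
    (Xᴴ * (U * diagonal f * Uᴴ) * Y * (V * diagonal g * Vᴴ)).trace =
      ∑ i, ∑ j, f i * g j * (star ((Uᴴ * X * V) i j) * (Uᴴ * Y * V) i j) := by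
  have h1 : (Xᴴ * (U * diagonal f * Uᴴ) * Y * (V * diagonal g * Vᴴ)).trace =
      ((Uᴴ * X * V)ᴴ * (diagonal f * ((Uᴴ * Y * V) * diagonal g))).trace := by
    have : Xᴴ * (U * diagonal f * Uᴴ) * Y * (V * diagonal g * Vᴴ) =
      (Xᴴ * (U * diagonal f * Uᴴ) * Y * (V * diagonal g)) * Vᴴ := by simp only [Matrix.mul_assoc]
    rw [this, Matrix.trace_mul_comm]
    simp only [Matrix.conjTranspose_mul, Matrix.conjTranspose_conjTranspose, Matrix.mul_assoc]
  rw [h1, Matrix.trace]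
  simp only [Matrix.diag_apply]
  rw [show (∑ i, ((Uᴴ * X * V)ᴴ * (diagonal f * ((Uᴴ * Y * V) * diagonal g))) i i)
    = ∑ i, ∑ j, (Uᴴ * X * V)ᴴ i j * (f j * ((Uᴴ * Y * V) j i * g i)) from ?_]
  · rw [Finset.sum_comm]
    refine Finset.sum_congr rfl fun i _ => Finset.sum_congr rfl fun j _ => ?_
    rw [Matrix.conjTranspose_apply]; ring
  · refine Finset.sum_congr rfl fun i _ => ?_
    rw [Matrix.mul_apply]
    refine Finset.sum_congr rfl fun j _ => ?_
    rw [Matrix.diagonal_mul, Matrix.mul_diagonal]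

/-- the affine majorant -/
noncomputable def ell {n : ℕ} (H : Matrix (Fin n) (Fin n) ℂ) (s : ℝ)
    (K A B : Matrix (Fin n) (Fin n) ℂ) : ℝ :=
  ((Hᴴ * A * H).trace.re - (2 * (Kᴴ * A * H).trace.re - (1 - s) * (Kᴴ * A * K).trace.re
    - s * (Kᴴ * K * B).trace.re)) / s

lemma D_pos {a b s : ℝ} (ha : 0 < a) (hb : 0 < b) (h0 : 0 ≤ s) (h1 : s ≤ 1) :
    0 < (1 - s) * a + s * b := by
  rcases h0.eq_or_lt with rfl | h
  · simpa using ha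
  · have := mul_nonneg (sub_nonneg.2 h1) ha.le
    have := mul_pos h hb
    linarith

lemma scalar_cont {a b : ℝ} (ha : 0 < a) (hb : 0 < b) :
    ContinuousOn (fun s : ℝ => a * (b - a) / ((1 - s) * a + s * b)) (Set.uIcc 0 1) := by
  apply ContinuousOn.div (by fun_prop) (by fun_prop)
  intro s hs
  rw [Set.uIcc_of_le zero_le_one] at hs
  exact (D_pos ha hb hs.1 hs.2).ne'

lemma scalar_int {a b : ℝ} (ha : 0 < a) (hb : 0 < b) :
    ∫ s in (0:ℝ)..1, a * (b - a) / ((1 - s) * a + s * b) = a * (Real.log b - Real.log a) := by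
  rw [intervalIntegral.integral_eq_sub_of_hasDerivAt
    (f := fun s => a * Real.log ((1 - s) * a + s * b))]
  · simp; ring
  · intro s hs
    rw [Set.uIcc_of_le zero_le_one] at hs
    have hD := D_pos ha hb hs.1 hs.2
    have h1 : HasDerivAt (fun s : ℝ => (1 - s) * a + s * b) (b - a) s := by
      have := (((hasDerivAt_id s).const_sub 1).mul_const a).add ((hasDerivAt_id s).mul_const b)
      exact HasDerivAt.congr_deriv (by exact this) (by ring)
    have := (h1.log hD.ne').const_mul a
    exact HasDerivAt.congr_deriv (by exact this) (by ring)
  · exact (scalar_cont ha hb).intervalIntegrable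

lemma rep {n : ℕ} (H A B : Matrix (Fin n) (Fin n) ℂ) (hA : A.PosDef) (hB : B.PosDef) :
    ∃ G : ℝ → ℝ, IntervalIntegrable G MeasureTheory.volume 0 1 ∧
      (Hᴴ * A * H * mlog B - H * Hᴴ * A * mlog A).trace = ((∫ s in (0:ℝ)..1, G s : ℝ) : ℂ) ∧
      ∀ s : ℝ, 0 < s → s ≤ 1 → (∀ K, G s ≤ ell H s K A B) ∧ ∃ K, G s = ell H s K A B := by
  obtain ⟨U, a, hU, hU', ha, hAe, hAl⟩ := pd_diag A hA
  obtain ⟨V, b, hV, hV', hb, hBe, hBl⟩ := pd_diag B hB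
  have h1 : (1 : Matrix (Fin n) (Fin n) ℂ) = V * diagonal (fun _ => (1:ℂ)) * Vᴴ := by
    rw [Matrix.diagonal_one, Matrix.mul_one, hV']
  have h1' : (1 : Matrix (Fin n) (Fin n) ℂ) = U * diagonal (fun _ => (1:ℂ)) * Uᴴ := by
    rw [Matrix.diagonal_one, Matrix.mul_one, hU']
  set M := Uᴴ * H * V with hM
  have key : ∀ (s : ℝ), 0 < s → s ≤ 1 → ∀ K, ell H s K A B =
      (∑ i, ∑ j, a i * (b j - a i) / ((1 - s) * a i + s * b j) * Complex.normSq (M i j)) +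
      ∑ i, ∑ j, ((1 - s) * a i + s * b j) / s *
        Complex.normSq ((Uᴴ * K * V) i j -
          ((a i / ((1 - s) * a i + s * b j) : ℝ) : ℂ) * M i j) := by
    intro s hs hs1 K
    have e1 : ∀ X Y : Matrix (Fin n) (Fin n) ℂ, (Xᴴ * A * Y).trace = 
        ∑ i, ∑ j, (a i : ℂ) * 1 * (star ((Uᴴ * X * V) i j) * (Uᴴ * Y * V) i j) := by
      intro X Y
      rw [← tr_formula, ← hAe, ← h1, Matrix.mul_one]
    have e2 : (Kᴴ * K * B).trace = 
        ∑ i, ∑ j, 1 * (b j : ℂ) * (star ((Uᴴ * K * V) i j) * (Uᴴ * K * V) i j) := by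
      rw [← tr_formula, ← hBe, ← h1', Matrix.mul_one]
    rw [ell, e1, e1, e1, e2, ← hM]
    simp only [Complex.re_sum, Finset.mul_sum, ← Finset.sum_sub_distrib, ← Finset.sum_add_distrib,
      Finset.sum_div]
    refine Finset.sum_congr rfl fun i _ => Finset.sum_congr rfl fun j _ => ?_
    have hD := D_pos (ha i) (hb j) hs.le hs1
    generalize (Uᴴ * K * V) i j = x
    generalize M i j = y
    simp only [Complex.normSq_apply, Complex.mul_re, Complex.mul_im, Complex.sub_re, Complex.sub_im,
      Complex.ofReal_re, Complex.ofReal_im, Complex.one_re, Complex.one_im, Complex.star_def,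
      Complex.conj_re, Complex.conj_im]
    have hs' := hs.ne'
    have hD' := hD.ne'
    obtain ⟨D, hDe⟩ : ∃ D, D = (1 - s) * a i + s * b j := ⟨_, rfl⟩
    rw [← hDe] at hD' ⊢
    have hbe : b j = (D - (1 - s) * a i) / s := by
      rw [hDe]; field_simp; ring
    rw [hbe]
    field_simp
    ring
  refine ⟨fun s => ∑ i, ∑ j, a i * (b j - a i) / ((1 - s) * a i + s * b j) *
    Complex.normSq (M i j), ?_, ?_, ?_⟩
  · apply ContinuousOn.intervalIntegrable
    refine continuousOn_finsetSum _ fun i _ => continuousOn_finsetSum _ fun j _ => ?_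
    exact (scalar_cont (ha i) (hb j)).mul continuousOn_const
  · have hI : ∀ i j, IntervalIntegrable (fun s : ℝ => a i * (b j - a i) /
        ((1 - s) * a i + s * b j) * Complex.normSq (M i j)) MeasureTheory.volume 0 1 := fun i j =>
      ((scalar_cont (ha i) (hb j)).mul continuousOn_const).intervalIntegrable
    rw [intervalIntegral.integral_finsetSum]
    swap
    · intro i _
      apply ContinuousOn.intervalIntegrable
      refine continuousOn_finsetSum _ fun j _ => ?_
      exact (scalar_cont (ha i) (hb j)).mul continuousOn_const
    simp_rw [intervalIntegral.integral_finsetSum (fun j _ => hI _ j),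
      intervalIntegral.integral_mul_const, scalar_int (ha _) (hb _)]
    have e3 : A * mlog A = U * diagonal (fun i => ((a i * Real.log (a i) : ℝ) : ℂ)) * Uᴴ := by
      rw [hAl]
      conv_lhs => rw [hAe]
      calc _ = U * (diagonal (fun i => (a i : ℂ)) * (Uᴴ * U) *
            diagonal (fun i => ((Real.log (a i) : ℝ) : ℂ))) * Uᴴ := by
            simp only [Matrix.mul_assoc]
        _ = _ := by
            rw [hU, Matrix.mul_one, Matrix.diagonal_mul_diagonal]
            simp only [Complex.ofReal_mul]
    have e4 : (H * Hᴴ * A * mlog A).trace = (Hᴴ * (A * mlog A) * H * 1).trace := by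
      rw [Matrix.mul_one, Matrix.trace_mul_comm _ H]
      simp only [Matrix.mul_assoc]
    rw [Matrix.trace_sub, e4, e3, h1, tr_formula, hBl]
    conv_lhs => enter [1]; rw [hAe]
    rw [tr_formula, ← hM]
    simp only [← Finset.sum_sub_distrib, Complex.ofReal_sum]
    refine Finset.sum_congr rfl fun i _ => Finset.sum_congr rfl fun j _ => ?_
    push_cast
    rw [Complex.normSq_eq_conj_mul_self, Complex.star_def]
    ring
  · intro s hs hs1
    refine ⟨fun K => ?_, U * (Matrix.of fun i j =>
      ((a i / ((1 - s) * a i + s * b j) : ℝ) : ℂ) * M i j) * Vᴴ, ?_⟩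
    · rw [key s hs hs1]
      refine le_add_of_nonneg_right (Finset.sum_nonneg fun i _ => Finset.sum_nonneg fun j _ => ?_)
      exact mul_nonneg (div_nonneg (D_pos (ha i) (hb j) hs.le hs1).le hs.le)
        (Complex.normSq_nonneg _)
    · rw [key s hs hs1]
      set N : Matrix (Fin n) (Fin n) ℂ := Matrix.of fun i j =>
        ((a i / ((1 - s) * a i + s * b j) : ℝ) : ℂ) * M i j with hN
      have : Uᴴ * (U * N * Vᴴ) * V = N := by
        calc _ = (Uᴴ * U) * N * (Vᴴ * V) := by simp only [Matrix.mul_assoc]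
          _ = N := by rw [hU, hV, Matrix.one_mul, Matrix.mul_one]
      rw [this]
      simp [hN]

lemma ell_affine {n : ℕ} (H K A₁ A₂ B₁ B₂ : Matrix (Fin n) (Fin n) ℂ) (s t : ℝ) :
    ell H s K (t • A₁ + (1 - t) • A₂) (t • B₁ + (1 - t) • B₂) =
      t * ell H s K A₁ B₁ + (1 - t) * ell H s K A₂ B₂ := by
  simp only [ell, Matrix.mul_add, Matrix.add_mul, Matrix.mul_smul, Matrix.smul_mul,
    Matrix.trace_add, Matrix.trace_smul, Complex.add_re, Complex.smul_re, smul_eq_mul]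
  ring

lemma pd_comb {n : ℕ} {A₁ A₂ : Matrix (Fin n) (Fin n) ℂ} (h₁ : A₁.PosDef) (h₂ : A₂.PosDef)
    {t : ℝ} (ht0 : 0 ≤ t) (ht1 : t ≤ 1) : (t • A₁ + (1 - t) • A₂).PosDef := by
  rcases ht0.eq_or_lt with rfl | h
  · simpa using h₂
  · exact (h₁.smul h).add_posSemidef (h₂.posSemidef.smul (sub_nonneg.2 ht1))

/-- For a contraction `H`, the map `(A, B) ↦ Tr(H*AH log B − HH*A log A)` is jointly
concave in pairs of positive definite matrices. -/
theorem trace_map_concave {n : ℕ} (H : Matrix (Fin n) (Fin n) ℂ)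
    (hH : (1 - Hᴴ * H).PosSemidef)
    (A₁ A₂ B₁ B₂ : Matrix (Fin n) (Fin n) ℂ)
    (hA₁ : A₁.PosDef) (hA₂ : A₂.PosDef) (hB₁ : B₁.PosDef) (hB₂ : B₂.PosDef)
    (t : ℝ) (ht0 : 0 ≤ t) (ht1 : t ≤ 1) :
    (Hᴴ * (t • A₁ + (1 - t) • A₂) * H * mlog (t • B₁ + (1 - t) • B₂)
        - H * Hᴴ * (t • A₁ + (1 - t) • A₂) * mlog (t • A₁ + (1 - t) • A₂)).trace ≥
      (t : ℂ) * (Hᴴ * A₁ * H * mlog B₁ - H * Hᴴ * A₁ * mlog A₁).trace +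
        (1 - (t : ℂ)) * (Hᴴ * A₂ * H * mlog B₂ - H * Hᴴ * A₂ * mlog A₂).trace := by
  obtain ⟨G, hGi, hG, hGs⟩ := rep H _ _ (pd_comb hA₁ hA₂ ht0 ht1) (pd_comb hB₁ hB₂ ht0 ht1)
  obtain ⟨G₁, hGi₁, hG₁, hGs₁⟩ := rep H _ _ hA₁ hB₁
  obtain ⟨G₂, hGi₂, hG₂, hGs₂⟩ := rep H _ _ hA₂ hB₂
  rw [hG, hG₁, hG₂, ge_iff_le]
  have : t * (∫ s in (0:ℝ)..1, G₁ s) + (1 - t) * (∫ s in (0:ℝ)..1, G₂ s) ≤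
      ∫ s in (0:ℝ)..1, G s := by
    rw [← intervalIntegral.integral_const_mul, ← intervalIntegral.integral_const_mul,
      ← intervalIntegral.integral_add (hGi₁.const_mul t) (hGi₂.const_mul (1 - t))]
    refine intervalIntegral.integral_mono_on_of_le_Ioo zero_le_one
      ((hGi₁.const_mul t).add (hGi₂.const_mul (1 - t))) hGi fun s hs => ?_
    obtain ⟨K, hK⟩ := (hGs s hs.1 hs.2.le).2
    rw [hK, ell_affine]
    exact add_le_add (mul_le_mul_of_nonneg_left ((hGs₁ s hs.1 hs.2.le).1 K) ht0)
      (mul_le_mul_of_nonneg_left ((hGs₂ s hs.1 hs.2.le).1 K) (sub_nonneg.2 ht1))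
  exact_mod_cast this
end
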